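/- arXiv:1801.04844 — 4 statements merged into one kernel-verified Lean document; each statement's English description precedes it below -/
import Mathlib

section
/- Let X and Y be compact Hausdorff connected topological spaces and let p : Y → X be a continuous surjection. Regard the C*-algebra C(Y) of continuous complex-valued functions on Y as a module over C(X) via (ξ · f)(y) = ξ(p(y)) · f(y) for f ∈ C(Y) and ξ ∈ C(X). If C(Y) is a finitely generated projective C(X)-module, then p is a covering map and every fiber p⁻¹(x), x ∈ X, is finite. -/
/-- The `C(X, ℂ)`-module structure on `C(Y, ℂ)` obtained by pulling back functions along
a continuous map `p : Y → X`, i.e. `(ξ • f) y = ξ (p y) * f y`. -/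
noncomputable def pullbackModule {X Y : Type*} [TopologicalSpace X] [TopologicalSpace Y]
    (p : C(Y, X)) : Module C(X, ℂ) C(Y, ℂ) :=
  Module.compHom C(Y, ℂ) (ContinuousMap.compRightAlgHom ℂ ℂ p).toRingHom

section Aux
variable {X Y : Type*} [TopologicalSpace X] [CompactSpace X] [T2Space X]
    [TopologicalSpace Y] [CompactSpace Y] [T2Space Y]

lemma aux_bump (s t : Set Y) (hs : IsClosed s) (ht : IsClosed t) (hd : Disjoint s t) :
    ∃ e : C(Y, ℂ), (∀ y ∈ s, e y = 0) ∧ (∀ y ∈ t, e y = 1) ∧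
      ∀ y, ∃ r : ℝ, 0 ≤ r ∧ r ≤ 1 ∧ e y = (r : ℂ) := by
  obtain ⟨f, h0, h1, h2⟩ := exists_continuous_zero_one_of_isClosed hs ht hd
  refine ⟨⟨fun y => (f y : ℂ), by fun_prop⟩, fun y hy => ?_, fun y hy => ?_,
    fun y => ⟨f y, (h2 y).1, (h2 y).2, rfl⟩⟩
  · simpa using h0 hy
  · simpa using h1 hy

lemma aux_delta (s : Finset Y) (y : Y) :
    ∃ e : C(Y, ℂ), e y = 1 ∧ ∀ z ∈ s, z ≠ y → e z = 0 := by
  obtain ⟨e, h0, h1, -⟩ := aux_bump ((s : Set Y) \ {y}) {y}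
    ((s.finite_toSet.subset Set.sdiff_subset).isClosed) isClosed_singleton
    Set.disjoint_sdiff_left
  exact ⟨e, h1 y rfl, fun z hz hne => h0 z ⟨hz, hne⟩⟩

/-- a C(X)-linear functional that is continuous is local -/
lemma aux_vanish (p : C(Y, X)) (φ : C(Y, ℂ) →ₗ[ℂ] C(X, ℂ)) (hc : Continuous φ)
    (hφ : ∀ (ξ : C(X, ℂ)) f, φ (ξ.comp p * f) = ξ * φ f) (f : C(Y, ℂ)) (x : X)
    (hf : ∀ y, p y = x → f y = 0) : φ f x = 0 := by
  have hcl : IsClosed {g : C(Y, ℂ) | φ g x = 0} :=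
    isClosed_eq ((continuous_eval_const x).comp hc) continuous_const
  have : f ∈ closure {g : C(Y, ℂ) | φ g x = 0} := by
    rw [Metric.mem_closure_iff]
    intro ε hε
    have hK : IsClosed {y | ε / 2 ≤ ‖f y‖} := isClosed_le continuous_const (by fun_prop)
    have hpK := p.continuous.isClosedMap _ hK
    obtain ⟨ξ, h0, h1, h2⟩ := aux_bump {x} _ isClosed_singleton hpK (by
      rw [Set.disjoint_singleton_left]
      rintro ⟨y, hy, rfl⟩
      have := hf y rfl
      simp only [Set.mem_ofPred_eq, this, norm_zero] at hy
      linarith)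
    refine ⟨ξ.comp p * f, ?_, ?_⟩
    · simp [hφ, h0 x rfl]
    · rw [dist_eq_norm]
      refine lt_of_le_of_lt ((ContinuousMap.norm_le _ (half_pos hε).le).2 fun y => ?_)
        (half_lt_self hε)
      simp only [ContinuousMap.sub_apply, ContinuousMap.mul_apply, ContinuousMap.comp_apply]
      by_cases hy : ε / 2 ≤ ‖f y‖
      · rw [h1 _ ⟨y, hy, rfl⟩]; simpa using (half_pos hε).le
      · obtain ⟨r, hr0, hr1, hr⟩ := h2 (p y)
        have e : f y - ξ (p y) * f y = ((1 - r : ℝ) : ℂ) * f y := by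
          rw [hr]; push_cast; ring
        rw [e, norm_mul, Complex.norm_real, Real.norm_of_nonneg (by linarith)]
        push Not at hy
        nlinarith [norm_nonneg (f y)]
  exact hcl.closure_subset this

lemma aux_cont (p : C(Y, X)) {n : ℕ} (F : Fin n → C(Y, ℂ))
    (Φ : Fin n → C(Y, ℂ) →ₗ[ℂ] C(X, ℂ))
    (hφ : ∀ i (ξ : C(X, ℂ)) f, Φ i (ξ.comp p * f) = ξ * Φ i f)
    (hF : ∀ f, f = ∑ i, (Φ i f).comp p * F i) (i : Fin n) : Continuous (Φ i) := by
  let S : (Fin n → C(X, ℂ)) →L[ℂ] C(Y, ℂ) :=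
    { toFun := fun c => ∑ i, (c i).comp p * F i
      map_add' := fun a b => by
        simp [← Finset.sum_add_distrib, ContinuousMap.add_comp, add_mul]
      map_smul' := fun a b => by
        simp [Finset.smul_sum, ContinuousMap.smul_comp]
      cont := by
        refine continuous_finsetSum _ fun i _ => ?_
        exact ((ContinuousMap.continuous_precomp p).comp (continuous_apply i)).mul
          continuous_const }
  have hS : Function.Surjective S := fun f => ⟨fun i => Φ i f, (hF f).symm⟩
  have hq := (S.isOpenMap hS).isQuotientMap S.continuous hS
  rw [hq.continuous_iff]
  have : (Φ i ∘ S) = fun c => ∑ j, c j * Φ i (F j) := by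
    funext c
    change Φ i (∑ j, (c j).comp p * F j) = _
    simp [hφ]
  rw [this]
  fun_prop

lemma aux_finite (p : C(Y, X)) {n : ℕ} (F : Fin n → C(Y, ℂ))
    (Φ : Fin n → C(Y, ℂ) →ₗ[ℂ] C(X, ℂ))
    (hF : ∀ f, f = ∑ i, (Φ i f).comp p * F i) (x : X) : (p ⁻¹' {x}).Finite := by
  by_contra hinf
  obtain ⟨s, hs, hcard⟩ := Set.Infinite.exists_subset_card_eq hinf (n + 1)
  let L : (Fin n → ℂ) →ₗ[ℂ] (s → ℂ) :=
    Fintype.linearCombination ℂ (fun i (y : s) => F i y)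
  have hL : Function.Surjective L := by
    intro v
    choose e he1 he0 using fun y : Y => aux_delta s y
    let f : C(Y, ℂ) := ∑ y : s, v y • e y
    refine ⟨fun i => Φ i f x, ?_⟩
    funext z
    have hz : p z = x := hs z.2
    have h1 : f z = v z := by
      simp only [f, ContinuousMap.sum_apply, ContinuousMap.smul_apply]
      rw [Finset.sum_eq_single z]
      · simp [he1]
      · intro b _ hb
        rw [he0 b z z.2 (fun h => hb (Subtype.ext h.symm))]; simp
      · simp
    rw [← h1]
    conv_rhs => rw [hF f]
    simp [L, Fintype.linearCombination_apply, hz]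
  have := LinearMap.finrank_le_finrank_of_surjective hL
  simp [hcard] at this

lemma aux_trace (p : C(Y, X)) {n : ℕ} (F : Fin n → C(Y, ℂ))
    (Φ : Fin n → C(Y, ℂ) →ₗ[ℂ] C(X, ℂ))
    (hφ : ∀ i (ξ : C(X, ℂ)) f, Φ i (ξ.comp p * f) = ξ * Φ i f)
    (hF : ∀ f, f = ∑ i, (Φ i f).comp p * F i) (g : C(Y, ℂ)) (x : X)
    (s : Finset Y) (hs : ∀ y, y ∈ s ↔ p y = x) :
    ∑ i, Φ i (g * F i) x = ∑ y ∈ s, g y := by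
  choose e he1 he0 using fun y : Y => aux_delta s y
  have h1 : ∀ i, Φ i (g * F i) x = ∑ y ∈ s, g y * F i y * Φ i (e y) x := by
    intro i
    have := aux_vanish p (Φ i) (aux_cont p F Φ hφ hF i) (hφ i)
      (g * F i - ∑ y ∈ s, (g y * F i y) • e y) x (by
        intro z hz
        have hz := (hs z).2 hz
        simp only [ContinuousMap.sub_apply, ContinuousMap.mul_apply, ContinuousMap.sum_apply,
          ContinuousMap.smul_apply]
        rw [Finset.sum_eq_single z]
        · simp [he1]
        · intro b _ hb
          rw [he0 b z hz hb.symm]; simp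
        · exact fun h => absurd hz h)
    simpa [sub_eq_zero] using this
  simp only [h1]
  rw [Finset.sum_comm]
  refine Finset.sum_congr rfl fun y hy => ?_
  have h2 : e y y = ∑ i, Φ i (e y) x * F i y := by
    conv_lhs => rw [hF (e y)]
    simp [(hs y).1 hy]
  rw [he1] at h2
  calc _ = g y * ∑ i, Φ i (e y) x * F i y := by
        rw [Finset.mul_sum]; exact Finset.sum_congr rfl fun i _ => by ring
    _ = g y := by rw [← h2, mul_one]

/-- Covering criterion from continuity of fibrewise sums. -/
lemma aux_cover (p : C(Y, X)) (hfin : ∀ x, (p ⁻¹' {x}).Finite)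
    (hT : ∀ g : C(Y, ℂ), Continuous fun x => ∑ y ∈ (hfin x).toFinset, g y) :
    IsCoveringMap p := by
  classical
  rw [← isLocalHomeomorph_iff_isCoveringMap]
  have hopen : IsOpenMap p := by
    rw [isOpenMap_iff_nhds_le]
    intro y V hV
    rw [Filter.mem_map] at hV
    obtain ⟨W, hWV, hW, hyW⟩ := mem_nhds_iff.1 hV
    obtain ⟨g, h0, h1, h2⟩ := aux_bump Wᶜ {y} hW.isClosed_compl isClosed_singleton
      (by simpa using hyW)
    choose r hr0 hr1 hr using h2
    have hne : ∑ z ∈ (hfin (p y)).toFinset, g z ≠ 0 := by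
      simp only [hr]
      rw [← Complex.ofReal_sum, Complex.ofReal_ne_zero]
      refine (Finset.sum_pos' (fun i _ => hr0 i) ⟨y, by simp, ?_⟩).ne'
      have := h1 y rfl
      rw [hr] at this
      norm_cast at this
      rw [this]; exact one_pos
    filter_upwards [(hT g).continuousAt.eventually_ne hne] with x hx
    obtain ⟨z, hz, hz'⟩ := Finset.exists_ne_zero_of_sum_ne_zero hx
    have hzx : p z = x := by simpa using hz
    rw [← hzx]
    apply hWV
    by_contra h
    exact hz' (h0 z h)
  rw [isLocalHomeomorph_iff_isOpenEmbedding_restrict]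
  intro y
  -- neighbourhood separating y from the rest of the fibre
  let R : Set Y := p ⁻¹' {p y} \ {y}
  have hR : IsClosed R := ((hfin (p y)).subset Set.sdiff_subset).isClosed
  obtain ⟨g, h0, h1, h2⟩ := aux_bump R {y} hR isClosed_singleton Set.disjoint_sdiff_left
  choose r hr0 hr1 hr using h2
  have hTy : ∑ z ∈ (hfin (p y)).toFinset, g z = 1 := by
    rw [Finset.sum_eq_single y]
    · exact h1 y rfl
    · intro z hz hne
      exact h0 z ⟨by simpa using hz, hne⟩
    · intro h; simp at h
  let V : Set Y := {z | 3 / 4 < (g z).re} ∩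
    p ⁻¹' {x | (∑ z ∈ (hfin x).toFinset, g z).re < 3 / 2}
  have hV : IsOpen V := by
    refine (isOpen_lt continuous_const (by fun_prop)).inter
      ((isOpen_lt (Complex.continuous_re.comp (hT g)) continuous_const).preimage p.continuous)
  have hyV : y ∈ V := by
    refine ⟨?_, ?_⟩
    · change 3 / 4 < (g y).re
      rw [h1 y rfl]; norm_num
    · change (∑ z ∈ (hfin (p y)).toFinset, g z).re < 3 / 2
      rw [hTy]; norm_num
  refine ⟨V, hV.mem_nhds hyV, ?_⟩
  refine Topology.IsOpenEmbedding.of_continuous_injective_isOpenMap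
    (p.continuous.comp continuous_subtype_val) ?_ (hopen.comp hV.isOpenMap_subtype_val)
  rintro ⟨a, ha⟩ ⟨b, hb⟩ hab
  have hab : p a = p b := hab
  by_contra hne
  have hne : a ≠ b := fun h => hne (Subtype.ext h)
  have hlt : (∑ z ∈ (hfin (p a)).toFinset, g z).re < 3 / 2 := ha.2
  have ha1 : 3 / 4 < (g a).re := ha.1
  have hb1 : 3 / 4 < (g b).re := hb.1
  have hsub : ({a, b} : Finset Y) ⊆ (hfin (p a)).toFinset := by
    intro z hz
    simp only [Finset.mem_insert, Finset.mem_singleton] at hz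
    rcases hz with rfl | rfl <;> simp [hab]
  rw [Complex.re_sum] at hlt
  have := Finset.sum_le_sum_of_subset_of_nonneg (f := fun z => (g z).re) hsub
    (fun i _ _ => by rw [hr]; exact hr0 i)
  rw [Finset.sum_pair hne] at this
  linarith
end Aux

/-- If `X`, `Y` are compact Hausdorff connected spaces, `p : Y → X` is a continuous surjection,
and `C(Y, ℂ)` is a finitely generated projective `C(X, ℂ)`-module (via pullback along `p`),
then `p` is a covering map with finite fibers. -/
theorem stmt0 {X Y : Type*} [TopologicalSpace X] [CompactSpace X] [T2Space X] [ConnectedSpace X]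
    [TopologicalSpace Y] [CompactSpace Y] [T2Space Y] [ConnectedSpace Y]
    (p : C(Y, X)) (hsurj : Function.Surjective p)
    (hfin : letI := pullbackModule p; Module.Finite C(X, ℂ) C(Y, ℂ))
    (hproj : letI := pullbackModule p; Module.Projective C(X, ℂ) C(Y, ℂ)) :
    IsCoveringMap p ∧ ∀ x : X, (p ⁻¹' {x}).Finite := by
  letI := pullbackModule p
  have hsm : ∀ (ξ : C(X, ℂ)) (f : C(Y, ℂ)), ξ • f = ξ.comp p * f := fun _ _ => rfl
  haveI : Module.Finite C(X, ℂ) C(Y, ℂ) := hfin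
  haveI : Module.Projective C(X, ℂ) C(Y, ℂ) := hproj
  obtain ⟨n, f, g, -, -, hfg⟩ :=
    Module.Finite.exists_comp_eq_id_of_projective C(X, ℂ) C(Y, ℂ)
  let F : Fin n → C(Y, ℂ) := fun i => f (Pi.single i 1)
  let Φ : Fin n → C(Y, ℂ) →ₗ[ℂ] C(X, ℂ) := fun i =>
    { toFun := fun h => g h i
      map_add' := fun a b => by simp
      map_smul' := fun c h => by
        have : c • h = (ContinuousMap.const X c) • h := by
          rw [hsm]; ext y; simp
        rw [this, map_smul]
        ext x; simp }
  have hφ : ∀ i (ξ : C(X, ℂ)) h, Φ i (ξ.comp p * h) = ξ * Φ i h := by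
    intro i ξ h
    change g (ξ.comp p * h) i = ξ * g h i
    rw [← hsm, map_smul]; rfl
  have hF : ∀ h, h = ∑ i, (Φ i h).comp p * F i := by
    intro h
    have h1 : f (g h) = h := LinearMap.congr_fun hfg h
    conv_lhs => rw [← h1, LinearMap.pi_apply_eq_sum_univ f (g h)]
    refine Finset.sum_congr rfl fun i _ => ?_
    rw [hsm]
    change _ = (g h i).comp p * f (Pi.single i 1)
    congr 2
    funext j
    simp [Pi.single_apply, eq_comm]
  have hfib := aux_finite p F Φ hF
  refine ⟨aux_cover p hfib fun k => ?_, hfib⟩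
  have : (fun x => ∑ y ∈ (hfib x).toFinset, k y) = fun x => ∑ i, Φ i (k * F i) x := by
    funext x
    exact (aux_trace p F Φ hφ hF k x _ (fun y => by simp)).symm
  rw [this]
  fun_prop
end

section
/- Let X and Y be compact Hausdorff spaces and let p : Y → X be a covering map all of whose fibers are finite. Then C(Y), regarded as a C(X)-module via (ξ · f)(y) = ξ(p(y)) · f(y) for f ∈ C(Y) and ξ ∈ C(X), is a finitely generated projective C(X)-module. -/
/-- Fibrewise sum. -/
noncomputable def fibTrace {X Y : Type*} [TopologicalSpace X] [TopologicalSpace Y]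
    (p : C(Y, X)) (f : C(Y, ℂ)) (x : X) : ℂ := ∑ᶠ y : p ⁻¹' {x}, f y

theorem fibTrace_continuous {X Y : Type*} [TopologicalSpace X] [TopologicalSpace Y]
    (p : C(Y, X)) (hcov : IsCoveringMap p) (hfib : ∀ x : X, (p ⁻¹' {x}).Finite)
    (f : C(Y, ℂ)) : Continuous (fibTrace p f) := by
  rw [continuous_iff_continuousAt]
  intro x
  obtain ⟨_, U, hxU, hU, _, H, hH⟩ := hcov x
  haveI : Fintype (p ⁻¹' {x}) := (hfib x).fintype
  have hres : ContinuousOn (fibTrace p f) U := by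
    rw [continuousOn_iff_continuous_domRestrict]
    have key : U.domRestrict (fibTrace p f) =
        fun u : U => ∑ i : p ⁻¹' {x}, f (H.symm (u, i)) := by
      funext u
      have hp : ∀ i, p (H.symm (u, i)) = u := fun i => by rw [← hH]; simp
      rw [← finsum_eq_sum_of_fintype]
      symm
      refine finsum_eq_of_bijective
        (fun i => (⟨H.symm (u, i), hp i⟩ : p ⁻¹' {(u : X)})) ⟨?_, ?_⟩ (fun i => rfl)
      · intro i j hij
        have h1 : H.symm (u, i) = H.symm (u, j) :=
          Subtype.ext (congrArg (fun z : p ⁻¹' {(u : X)} => (z : Y)) hij)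
        exact (Prod.ext_iff.1 (H.symm.injective h1)).2
      · rintro ⟨y, hy⟩
        have hy' : p y = u := hy
        have hyU : y ∈ p ⁻¹' U := by
          show p y ∈ U
          rw [hy']; exact u.2
        refine ⟨(H ⟨y, hyU⟩).2, Subtype.ext ?_⟩
        have h2 : (u, (H ⟨y, hyU⟩).2) = H ⟨y, hyU⟩ := by
          refine Prod.ext (Subtype.ext ?_) rfl
          rw [hH]; exact hy'.symm
        show ((H.symm (u, (H ⟨y, hyU⟩).2)) : Y) = y
        rw [h2]; simp
    rw [key]
    fun_prop
  exact hres.continuousAt (hU.mem_nhds hxU)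

theorem exists_frame {X Y : Type*} [TopologicalSpace X]
    [TopologicalSpace Y] [CompactSpace Y] [T2Space Y]
    (p : C(Y, X)) (hcov : IsCoveringMap p) :
    ∃ (t : Finset Y) (e : t → C(Y, ℂ)), (∀ y, ∑ j, e j y * e j y = 1) ∧
      ∀ j y z, p y = p z → y ≠ z → e j y * e j z = 0 := by
  have h1 : ∀ y : Y, ∃ V : Set Y, IsOpen V ∧ y ∈ V ∧ Set.InjOn p V := by
    intro y
    obtain ⟨e, hy, he⟩ := hcov.isLocalHomeomorph y
    exact ⟨e.source, e.open_source, hy, he ▸ e.injOn⟩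
  choose V hVo hyV hVi using h1
  obtain ⟨t, ht⟩ := CompactSpace.elim_nhds_subcover V (fun y => (hVo y).mem_nhds (hyV y))
  obtain ⟨ρ, hρ⟩ := PartitionOfUnity.exists_isSubordinate (s := (Set.univ : Set Y)) isClosed_univ
    (fun j : t => V j) (fun j => hVo j) (by
      intro y _
      have : y ∈ ⋃ x ∈ t, V x := ht ▸ trivial
      simpa using this)
  refine ⟨t, fun j => ⟨fun y => ((Real.sqrt (ρ j y) : ℝ) : ℂ), by fun_prop⟩, ?_, ?_⟩
  · intro y
    have := ρ.sum_eq_one (Set.mem_univ y)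
    rw [finsum_eq_sum_of_fintype] at this
    simp only [ContinuousMap.coe_mk]
    have h2 : ∀ j, Real.sqrt (ρ j y) * Real.sqrt (ρ j y) = ρ j y :=
      fun j => Real.mul_self_sqrt (ρ.nonneg j y)
    rw [← Complex.ofReal_one, ← this, Complex.ofReal_sum]
    refine Finset.sum_congr rfl fun j _ => ?_
    rw [← Complex.ofReal_mul, h2]
  · intro j y z hp hne
    by_contra hcon
    simp only [ContinuousMap.coe_mk] at hcon
    have hin : ∀ w, ((Real.sqrt (ρ j w) : ℝ) : ℂ) ≠ 0 → w ∈ V j := by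
      intro w hw
      apply hρ j
      apply subset_tsupport
      intro h0
      apply hw
      rw [h0]; simp
    exact hne (hVi j (hin y (left_ne_zero_of_mul hcon)) (hin z (right_ne_zero_of_mul hcon)) hp)

/-- If `X`, `Y` are compact Hausdorff spaces and `p : Y → X` is a covering map with finite
fibers, then `C(Y, ℂ)` is a finitely generated projective `C(X, ℂ)`-module, where the module
structure is given by `(ξ • f) y = ξ (p y) * f y`. -/
theorem stmt1 {X Y : Type*} [TopologicalSpace X] [CompactSpace X] [T2Space X]
    [TopologicalSpace Y] [CompactSpace Y] [T2Space Y]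
    (p : C(Y, X)) (hcov : IsCoveringMap p) (hfib : ∀ x : X, (p ⁻¹' {x}).Finite) :
    (letI := pullbackModule p; Module.Finite C(X, ℂ) C(Y, ℂ)) ∧
    (letI := pullbackModule p; Module.Projective C(X, ℂ) C(Y, ℂ)) := by
  obtain ⟨t, e, he1, he2⟩ := exists_frame p hcov
  letI := pullbackModule p
  have hsm : ∀ (ξ : C(X, ℂ)) (f : C(Y, ℂ)) (y : Y), (ξ • f) y = ξ (p y) * f y :=
    fun _ _ _ => rfl
  haveI hfi : ∀ x, Finite (p ⁻¹' {x}) := fun x => (hfib x)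
  let s : C(Y, ℂ) →ₗ[C(X, ℂ)] (t → C(X, ℂ)) :=
    { toFun := fun f j => ⟨fibTrace p (e j * f), fibTrace_continuous p hcov hfib _⟩
      map_add' := by
        intro f g
        funext j
        ext x
        simp only [fibTrace, ContinuousMap.coe_mk, Pi.add_apply, ContinuousMap.add_apply,
          ContinuousMap.mul_apply, mul_add]
        exact finsum_add_distrib (Set.toFinite _) (Set.toFinite _)
      map_smul' := by
        intro ξ f
        funext j
        ext x
        simp only [fibTrace, ContinuousMap.coe_mk, Pi.smul_apply, smul_eq_mul,
          ContinuousMap.mul_apply, hsm, RingHom.id_apply]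
        rw [mul_finsum]
        refine finsum_congr fun y => ?_
        have : p y = x := y.2
        rw [this]; ring }
  let r : (t → C(X, ℂ)) →ₗ[C(X, ℂ)] C(Y, ℂ) :=
    Fintype.linearCombination C(X, ℂ) e
  have hrs : r ∘ₗ s = LinearMap.id := by
    ext f y
    have h1 : (r (s f)) y = ∑ j, fibTrace p (e j * f) (p y) * e j y := by
      simp only [r, Fintype.linearCombination_apply, ContinuousMap.sum_apply, hsm]
      rfl
    have h2 : ∀ j, fibTrace p (e j * f) (p y) * e j y = (e j y * e j y) * f y := by
      intro j
      rw [fibTrace, finsum_mul]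
      rw [finsum_eq_single _ (⟨y, rfl⟩ : p ⁻¹' {p y})]
      · simp only [ContinuousMap.mul_apply]; ring
      · intro z hz
        have h3 := he2 j z y z.2 (fun h => hz (Subtype.ext h))
        simp only [ContinuousMap.mul_apply]
        linear_combination f z * h3
    show (r (s f)) y = f y
    rw [h1, Finset.sum_congr rfl (fun j _ => h2 j), ← Finset.sum_mul, he1, one_mul]
  refine ⟨Module.Finite.of_surjective r fun f => ⟨s f, LinearMap.congr_fun hrs f⟩,
    Module.Projective.of_split s r hrs⟩
end

section
/- Let B̃ be a unital C*-algebra with a finite group G acting by *-automorphisms, with non-degenerate action, let B = B̃^G, and suppose (B, B̃, G) is a unital noncommutative finite-fold covering (B̃ is a finitely generated projective B-module). Let A ⊆ B be a closed two-sided essential ideal of B, and set Ã = {a ∈ B̃ : Σ_{g∈G} g(b* a) ∈ A for all b ∈ B̃}. Then A equals the ℂ-linear span of the set {Σ_{g∈G} g(x* y) : x, y ∈ Ã}. -/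
open Finset

/-- The self-adjoint part of a closed ideal, as a star subalgebra. -/
def idealStar {B : Type*} [CStarAlgebra B] (R I : Set B) (hIR : I ⊆ R)
    (hI0 : (0 : B) ∈ I) (hIadd : ∀ a ∈ I, ∀ b ∈ I, a + b ∈ I)
    (hIs : ∀ (c : ℂ), ∀ a ∈ I, c • a ∈ I)
    (hIideal : ∀ a ∈ I, ∀ b ∈ R, b * a ∈ I ∧ a * b ∈ I) : NonUnitalStarSubalgebra ℂ B where
  carrier := {x | x ∈ I ∧ star x ∈ I}
  zero_mem' := by simpa using hI0
  add_mem' := by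
    rintro a b ⟨h1, h2⟩ ⟨h3, h4⟩
    exact ⟨hIadd _ h1 _ h3, by rw [star_add]; exact hIadd _ h2 _ h4⟩
  mul_mem' := by
    rintro a b ⟨h1, h2⟩ ⟨h3, h4⟩
    exact ⟨(hIideal _ h1 _ (hIR h3)).2, by rw [star_mul]; exact (hIideal _ h2 _ (hIR h4)).1⟩
  smul_mem' := by
    rintro c a ⟨h1, h2⟩
    exact ⟨hIs _ _ h1, by rw [star_smul]; exact hIs _ _ h2⟩
  star_mem' := by
    rintro a ⟨h1, h2⟩
    exact ⟨h2, by simpa using h1⟩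

theorem ideal_cfc {B : Type*} [CStarAlgebra B] (R I : Set B) (hIR : I ⊆ R)
    (hIclosed : IsClosed I)
    (hI0 : (0 : B) ∈ I) (hIadd : ∀ a ∈ I, ∀ b ∈ I, a + b ∈ I)
    (hIs : ∀ (c : ℂ), ∀ a ∈ I, c • a ∈ I)
    (hIideal : ∀ a ∈ I, ∀ b ∈ R, b * a ∈ I ∧ a * b ∈ I)
    (a : B) (ha : a ∈ I) (hsa : IsSelfAdjoint a) (f : ℝ → ℝ) (hf : Continuous f)
    (hf0 : f 0 = 0) : cfc f a ∈ I := by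
  let J := idealStar R I hIR hI0 hIadd hIs hIideal
  have hJ : IsClosed (J : Set B) := by
    change IsClosed {x | x ∈ I ∧ star x ∈ I}
    exact hIclosed.inter (hIclosed.preimage continuous_star)
  have haJ : a ∈ J := ⟨ha, by rw [hsa.star_eq]; exact ha⟩
  have h : cfcₙ f a ∈ J := cfcₙ_mem (𝕜' := ℂ) (hs := hJ) f haJ
  rw [cfcₙ_eq_cfc hf.continuousOn hf0] at h
  exact h.1

theorem ideal_star {B : Type*} [CStarAlgebra B] (R I : Set B) (hIR : I ⊆ R)
    (hRs : ∀ x ∈ R, star x ∈ R)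
    (hIclosed : IsClosed I)
    (hI0 : (0 : B) ∈ I) (hIadd : ∀ a ∈ I, ∀ b ∈ I, a + b ∈ I)
    (hIs : ∀ (c : ℂ), ∀ a ∈ I, c • a ∈ I)
    (hIideal : ∀ a ∈ I, ∀ b ∈ R, b * a ∈ I ∧ a * b ∈ I)
    (a : B) (ha : a ∈ I) : star a ∈ I := by
  rw [← hIclosed.closure_eq, Metric.mem_closure_iff]
  intro ε hε
  have hh : star a * a ∈ I := (hIideal a ha _ (hRs _ (hIR ha))).1
  have hsa : IsSelfAdjoint (star a * a) := IsSelfAdjoint.star_mul_self a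
  set h := star a * a with hdef
  obtain ⟨δ, hδ, hδε⟩ : ∃ δ : ℝ, 0 < δ ∧ δ < ε ^ 2 := exists_between (by positivity)
  let f : ℝ → ℝ := fun t => min 1 (|t| / δ)
  have hf : Continuous f := by fun_prop
  have heI : cfc f h ∈ I := ideal_cfc R I hIR hIclosed hI0 hIadd hIs hIideal h hh hsa f hf
    (by simp [f])
  have hes : star (cfc f h) = cfc f h := (cfc_predicate f h : IsSelfAdjoint _).star_eq
  refine ⟨cfc f h * star a, (hIideal _ heI _ (hRs _ (hIR ha))).2, ?_⟩
  have h1 : cfc (fun t => (1 - f t) * (t * (1 - f t))) h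
      = (1 - cfc f h) * (h * (1 - cfc f h)) := by
    have e1 : cfc (fun t => 1 - f t) h = 1 - cfc f h := by
      rw [cfc_sub (fun _ => (1 : ℝ)) f h (by fun_prop) (by fun_prop), cfc_const_one ℝ h]
    rw [cfc_mul (fun t => 1 - f t) (fun t => t * (1 - f t)) h (by fun_prop) (by fun_prop),
      cfc_mul (fun t => t) (fun t => 1 - f t) h (by fun_prop) (by fun_prop), e1, cfc_id' ℝ h]
  have h2 : ‖cfc (fun t => (1 - f t) * (t * (1 - f t))) h‖ ≤ δ := by
    refine norm_cfc_le hδ.le fun t _ => ?_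
    rw [norm_mul, norm_mul]
    simp only [Real.norm_eq_abs, f]
    rcases le_total δ |t| with h | h
    · rw [min_eq_left ((one_le_div hδ).2 h)]; simpa using hδ.le
    · have h3 : |t| / δ ≤ 1 := (div_le_one hδ).2 h
      have h4 : 0 ≤ |t| / δ := by positivity
      rw [min_eq_right h3, abs_of_nonneg (sub_nonneg.2 h3)]
      have h5 : 1 - |t| / δ ≤ 1 := by linarith
      have h6 : 0 ≤ 1 - |t| / δ := by linarith
      calc _ ≤ 1 * (|t| * 1) := by gcongr
        _ ≤ δ := by simpa using h
  have h3 : ‖star a - cfc f h * star a‖ * ‖star a - cfc f h * star a‖ ≤ δ := by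
    rw [← CStarRing.norm_self_mul_star]
    refine le_of_eq_of_le ?_ h2
    rw [h1]
    congr 1
    rw [star_sub, star_mul, star_star, hes, hdef]
    noncomm_ring
  rw [dist_eq_norm]
  nlinarith [norm_nonneg (star a - cfc f h * star a)]

theorem ideal_factor {B : Type*} [CStarAlgebra B] (R I : Set B) (hIR : I ⊆ R)
    (hIclosed : IsClosed I)
    (hI0 : (0 : B) ∈ I) (hIadd : ∀ a ∈ I, ∀ b ∈ I, a + b ∈ I)
    (hIs : ∀ (c : ℂ), ∀ a ∈ I, c • a ∈ I)
    (hIideal : ∀ a ∈ I, ∀ b ∈ R, b * a ∈ I ∧ a * b ∈ I)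
    (a : B) (ha : a ∈ I) (hsa : IsSelfAdjoint a) :
    ∃ x ∈ I, ∃ y ∈ I, a = star x * y := by
  let f : ℝ → ℝ := fun t => √|t|
  let k : ℝ → ℝ := fun t => √(max t 0) - √(max (-t) 0)
  have hf : Continuous f := by fun_prop
  have hk : Continuous k := by fun_prop
  have hes : star (cfc f a) = cfc f a := (cfc_predicate f a : IsSelfAdjoint _).star_eq
  refine ⟨cfc f a, ideal_cfc R I hIR hIclosed hI0 hIadd hIs hIideal a ha hsa f hf (by simp [f]),
    cfc k a, ideal_cfc R I hIR hIclosed hI0 hIadd hIs hIideal a ha hsa k hk (by simp [k]), ?_⟩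
  rw [hes, ← cfc_mul f k a (by fun_prop) (by fun_prop)]
  have : (fun t => f t * k t) = fun t => t := by
    funext t
    simp only [f, k]
    rcases le_total 0 t with h | h
    · rw [abs_of_nonneg h, max_eq_left h, max_eq_right (by linarith)]
      simp [Real.mul_self_sqrt h]
    · rw [abs_of_nonpos h, max_eq_right h, max_eq_left (by linarith)]
      simp [Real.mul_self_sqrt (neg_nonneg.2 h)]
  rw [this, cfc_id' ℝ a]

/-- Let `(B, B̃, G)` be a unital noncommutative finite-fold covering (`B̃` a unital
C*-algebra, `G` finite acting by *-automorphisms, non-degenerately, `B = B̃^G`, and `B̃`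
finitely generated projective over `B`).  Let `A ⊆ B` be a closed two-sided essential ideal
of `B` and let `Ã = {a ∈ B̃ : ∑_g g(b* a) ∈ A for all b ∈ B̃}`.  Then `A` equals the
`ℂ`-linear span of `{∑_g g(x* y) : x, y ∈ Ã}`. -/
theorem stmt10 {B : Type*} [NormedRing B] [StarRing B] [CStarRing B] [NormedAlgebra ℂ B]
    [StarModule ℂ B] [CompleteSpace B]
    (G : Type*) [Group G] [Fintype G] [MulSemiringAction G B]
    (hsmulC : ∀ (g : G) (c : ℂ) (b : B), g • (c • b) = c • (g • b))
    (hstar : ∀ (g : G) (b : B), g • (star b) = star (g • b))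
    (hnondeg : ∀ g : G, g ≠ 1 → ∃ b : B, g • b ≠ b)
    (R : Subring B) (hR : ∀ b : B, b ∈ R ↔ ∀ g : G, g • b = b)
    (hfin : letI : Module R B := Module.compHom B R.subtype; Module.Finite R B)
    (hproj : letI : Module R B := Module.compHom B R.subtype; Module.Projective R B)
    -- `I` is a closed two-sided essential ideal of `R = B̃^G`
    (I : Set B) (hIR : I ⊆ (R : Set B)) (hIclosed : IsClosed I)
    (hI0 : (0 : B) ∈ I) (hIadd : ∀ a ∈ I, ∀ b ∈ I, a + b ∈ I) (hIneg : ∀ a ∈ I, -a ∈ I)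
    (hIideal : ∀ a ∈ I, ∀ b ∈ R, b * a ∈ I ∧ a * b ∈ I)
    (hIess : ∀ b ∈ R, (∀ a ∈ I, b * a = 0) → b = 0) :
    (↑(Submodule.span ℂ {z : B | ∃ x ∈ {a : B | ∀ b : B, (∑ g : G, g • (star b * a)) ∈ I},
        ∃ y ∈ {a : B | ∀ b : B, (∑ g : G, g • (star b * a)) ∈ I},
        z = ∑ g : G, g • (star x * y)}) : Set B) = I := by
  classical
  letI : CStarAlgebra B := {}
  have hc1 : ∀ c : ℂ, c • (1 : B) ∈ R := fun c => (hR _).2 fun g => by rw [hsmulC, smul_one]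
  have hIs : ∀ (c : ℂ), ∀ a ∈ I, c • a ∈ I := fun c a ha => by
    simpa using (hIideal a ha _ (hc1 c)).1
  have hRs : ∀ x ∈ (R : Set B), star x ∈ (R : Set B) := fun x hx => (hR _).2 fun g => by
    rw [hstar, (hR x).1 hx g]
  have hfix : ∀ a ∈ I, ∀ g : G, g • a = a := fun a ha => (hR a).1 (hIR ha)
  have hE : ∀ b : B, ∑ g : G, g • b ∈ R := fun b => (hR _).2 fun k => by
    rw [Finset.smul_sum]
    simp_rw [← mul_smul]
    exact Fintype.sum_equiv (Equiv.mulLeft k) _ _ (fun _ => rfl)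
  have hIA : ∀ a ∈ I, ∀ b : B, (∑ g : G, g • (star b * a)) ∈ I := fun a ha b => by
    simp_rw [smul_mul', hfix a ha, ← Finset.sum_mul]
    exact (hIideal a ha _ (hE _)).1
  have hst := ideal_star (R : Set B) I hIR hRs hIclosed hI0 hIadd hIs hIideal
  apply Set.Subset.antisymm
  · intro z hz
    induction hz using Submodule.span_induction with
    | mem z hz => obtain ⟨x, hx, y, hy, rfl⟩ := hz; exact hy x
    | zero => exact hI0
    | add x y _ _ hx hy => exact hIadd _ hx _ hy
    | smul c x _ hx => exact hIs c x hx
  · have key : ∀ a ∈ I, IsSelfAdjoint a → a ∈ Submodule.span ℂ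
        {z : B | ∃ x ∈ {a : B | ∀ b : B, (∑ g : G, g • (star b * a)) ∈ I},
        ∃ y ∈ {a : B | ∀ b : B, (∑ g : G, g • (star b * a)) ∈ I},
        z = ∑ g : G, g • (star x * y)} := by
      intro a ha hsa
      obtain ⟨x, hx, y, hy, rfl⟩ :=
        ideal_factor (R : Set B) I hIR hIclosed hI0 hIadd hIs hIideal a ha hsa
      have h1 : ∑ g : G, g • (star x * y) = (Fintype.card G : ℂ) • (star x * y) := by
        simp_rw [hfix _ ha]
        simp [Nat.cast_smul_eq_nsmul]
      have h0 : (Fintype.card G : ℂ) ≠ 0 := by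
        exact_mod_cast Fintype.card_ne_zero
      rw [← inv_smul_smul₀ h0 (star x * y), ← h1]
      exact Submodule.smul_mem _ _
        (Submodule.subset_span ⟨x, hIA x hx, y, hIA y hy, rfl⟩)
    intro a ha
    have e1 : a + star a ∈ I := hIadd _ ha _ (hst a ha)
    have e2 : Complex.I • (a - star a) ∈ I := hIs _ _ (by
      rw [sub_eq_add_neg]; exact hIadd _ ha _ (hIneg _ (hst a ha)))
    have k1 := key _ e1 (by rw [IsSelfAdjoint, star_add, star_star, add_comm])
    have k2 := key _ e2 (by
      rw [IsSelfAdjoint, star_smul, star_sub, star_star]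
      simp only [Complex.star_def, Complex.conj_I, neg_smul, ← smul_neg, neg_sub])
    have : a = (1 / 2 : ℂ) • (a + star a) + (-Complex.I / 2) • (Complex.I • (a - star a)) := by
      rw [smul_smul]
      have : -Complex.I / 2 * Complex.I = 1 / 2 := by
        linear_combination (-1 / 2 : ℂ) * Complex.I_mul_I
      rw [this]
      module
    rw [this]
    exact Submodule.add_mem _ (Submodule.smul_mem _ _ k1) (Submodule.smul_mem _ _ k2)
end

section
/- Let Ã be a C*-algebra with a finite group G acting by *-automorphisms, with non-degenerate action, and let A = Ã^G be the fixed-point subalgebra. Suppose there is a family {I_λ}_{λ∈Λ} of closed two-sided ideals of A whose union ∪_λ I_λ is dense in A, such that for every λ the ℂ-linear span of {Σ_{g∈G} g(x* y) : x, y ∈ I_λ Ã I_λ} equals I_λ (where I_λ Ã I_λ denotes the closed subalgebra of Ã generated by products i·a·i' with i, i' ∈ I_λ and a ∈ Ã). Then the closed ℂ-linear span of {Σ_{g∈G} g(x* y) : x, y ∈ Ã} equals A, i.e. the A-valued inner product ⟨x,y⟩_A = Σ_{g∈G} g(x* y) on Ã is full. -/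
open Finset

/-- `IλÃIλ` : the closed subalgebra of `Ã` generated by the products `i * a * i'` with
`i, i' ∈ I` and `a ∈ Ã` (the closure of the linear span of such products, which is already
closed under multiplication). -/
def cornerSet {A : Type*} [NonUnitalNormedRing A] [NormedSpace ℂ A] (I : Set A) : Set A :=
  closure (↑(Submodule.span ℂ {w : A | ∃ i ∈ I, ∃ i' ∈ I, ∃ a : A, w = i * a * i'}) : Set A)

/-- Let a finite group `G` act non-degenerately on a C*-algebra `Ã` by *-automorphisms and
let `A = Ã^G`.  Suppose `{I_λ}` is a family of closed two-sided ideals of `A` with dense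
union in `A` such that for every `λ` the `ℂ`-span of `{∑_g g(x* y) : x, y ∈ I_λ Ã I_λ}`
equals `I_λ`.  Then the closed `ℂ`-span of `{∑_g g(x* y) : x, y ∈ Ã}` equals `A`, i.e. the
`A`-valued inner product `⟨x,y⟩_A = ∑_g g(x* y)` on `Ã` is full. -/
theorem stmt12 {A : Type*} [NonUnitalNormedRing A] [StarRing A] [CStarRing A]
    [NormedSpace ℂ A] [IsScalarTower ℂ A A] [SMulCommClass ℂ A A] [StarModule ℂ A]
    [CompleteSpace A]
    (G : Type*) [Group G] [Fintype G] [DistribMulAction G A]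
    (hmul : ∀ (g : G) (a b : A), g • (a * b) = (g • a) * (g • b))
    (hsmulC : ∀ (g : G) (c : ℂ) (a : A), g • (c • a) = c • (g • a))
    (hstar : ∀ (g : G) (a : A), g • (star a) = star (g • a))
    (hnondeg : ∀ g : G, g ≠ 1 → ∃ a : A, g • a ≠ a)
    (Λ : Type*) (I : Λ → Set A)
    -- each `I λ` is a closed two-sided ideal of the fixed-point algebra `A = Ã^G`
    (hIF : ∀ l, I l ⊆ {a : A | ∀ g : G, g • a = a})
    (hIclosed : ∀ l, IsClosed (I l))
    (hI0 : ∀ l, (0 : A) ∈ I l)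
    (hIadd : ∀ l, ∀ a ∈ I l, ∀ b ∈ I l, a + b ∈ I l)
    (hIneg : ∀ l, ∀ a ∈ I l, -a ∈ I l)
    (hIideal : ∀ l, ∀ a ∈ I l, ∀ b : A, (∀ g : G, g • b = b) → b * a ∈ I l ∧ a * b ∈ I l)
    -- the union `⋃ λ, I λ` is dense in `A`
    (hdense : {a : A | ∀ g : G, g • a = a} ⊆ closure (⋃ l, I l))
    -- for each `λ`, the `ℂ`-span of `{∑_g g(x* y) : x, y ∈ I_λ Ã I_λ}` equals `I_λ`
    (hspan : ∀ l, (↑(Submodule.span ℂ {z : A | ∃ x ∈ cornerSet (I l), ∃ y ∈ cornerSet (I l),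
        z = ∑ g : G, g • (star x * y)}) : Set A) = I l) :
    closure (↑(Submodule.span ℂ {z : A | ∃ x y : A, z = ∑ g : G, g • (star x * y)}) : Set A)
      = {a : A | ∀ g : G, g • a = a} := by
  have hcont : ∀ g : G, Continuous (fun a : A => g • a) := by
    intro g
    letI : NonUnitalCStarAlgebra A := { }
    let φ : A →⋆ₙₐ[ℂ] A :=
      { toFun := fun a => g • a
        map_smul' := fun c a => hsmulC g c a
        map_zero' := smul_zero g
        map_add' := smul_add g
        map_mul' := hmul g
        map_star' := hstar g }
    have h : ∀ a : A, ‖φ a‖ ≤ 1 * ‖a‖ := fun a => by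
      rw [one_mul]; exact NonUnitalStarAlgHom.norm_apply_le φ a
    exact AddMonoidHomClass.continuous_of_bound φ 1 h
  apply Set.Subset.antisymm
  · apply closure_minimal
    · intro z hz
      induction hz using Submodule.span_induction with
      | mem z hz =>
        obtain ⟨x, y, rfl⟩ := hz
        intro h
        rw [Finset.smul_sum]
        simp only [smul_smul]
        exact Fintype.sum_equiv (Equiv.mulLeft h) _ _ (fun _ => rfl)
      | zero => intro g; exact smul_zero g
      | add x y _ _ hx hy => intro g; rw [smul_add, hx g, hy g]
      | smul c x _ hx => intro g; rw [hsmulC, hx g]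
    · rw [Set.setOf_forall]
      exact isClosed_iInter fun g => isClosed_eq (hcont g) continuous_id
  · refine hdense.trans (closure_mono (Set.iUnion_subset fun l => ?_))
    rw [← hspan l]
    refine Submodule.span_mono ?_
    rintro z ⟨x, _, y, _, rfl⟩
    exact ⟨x, y, rfl⟩
end
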